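/- PA(Ver) is a conservative extension of PA: for every L_A-sentence φ, if PA(Ver) ⊢ φ then PA ⊢ φ. In particular, PA(Ver) is L_A-sound, i.e., every L_A-sentence provable in PA(Ver) is true in the standard model ℕ. -/

import Mathlib

namespace ModalArith

/-- Terms of the language of arithmetic L_A = {0, S, +, ×, ≤, =}. -/
inductive Term : Type
  | var : ℕ → Term
  | zero : Term
  | succ : Term → Term
  | add : Term → Term → Term
  | mul : Term → Term → Term
  deriving DecidableEq

namespace Term

/-- Free variables of a term. -/
def fv : Term → Finset ℕ
  | var x => {x}
  | zero => ∅
  | succ t => fv t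
  | add t u => fv t ∪ fv u
  | mul t u => fv t ∪ fv u

/-- Simultaneous substitution of terms for variables. -/
def substAll : Term → (ℕ → Term) → Term
  | var x, v => v x
  | zero, _ => zero
  | succ t, v => succ (substAll t v)
  | add t u, v => add (substAll t v) (substAll u v)
  | mul t u, v => mul (substAll t v) (substAll u v)

/-- Substitution of the term `s` for the variable `x`. -/
def subst (x : ℕ) (s : Term) (t : Term) : Term :=
  substAll t (Function.update Term.var x s)

/-- The numeral `n̄`. -/
def numeral : ℕ → Term
  | 0 => zero
  | n + 1 => succ (numeral n)

/-- Value of a term in the standard model under a valuation. -/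
def val : Term → (ℕ → ℕ) → ℕ
  | var x, v => v x
  | zero, _ => 0
  | succ t, v => val t v + 1
  | add t u, v => val t v + val u v
  | mul t u, v => val t v * val u v

/-- A Gödel numbering of terms. -/
def code : Term → ℕ
  | var x => Nat.pair 0 x
  | zero => Nat.pair 1 0
  | succ t => Nat.pair 2 (code t)
  | add t u => Nat.pair 3 (Nat.pair (code t) (code u))
  | mul t u => Nat.pair 4 (Nat.pair (code t) (code u))

end Term

/-- Formulas of the language L_□ of modal arithmetic. -/
inductive Formula : Type
  | falsum : Formula
  | eq : Term → Term → Formula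
  | le : Term → Term → Formula
  | and : Formula → Formula → Formula
  | or : Formula → Formula → Formula
  | imp : Formula → Formula → Formula
  | neg : Formula → Formula
  | all : ℕ → Formula → Formula
  | ex : ℕ → Formula → Formula
  | box : Formula → Formula
  deriving DecidableEq

namespace Formula

/-- Free variables of a formula. -/
def fv : Formula → Finset ℕ
  | falsum => ∅
  | eq t u => t.fv ∪ u.fv
  | le t u => t.fv ∪ u.fv
  | and φ ψ => fv φ ∪ fv ψ
  | or φ ψ => fv φ ∪ fv ψ
  | imp φ ψ => fv φ ∪ fv ψ
  | neg φ => fv φ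
  | all x φ => (fv φ).erase x
  | ex x φ => (fv φ).erase x
  | box φ => fv φ

/-- Simultaneous substitution of terms for the free variables of a formula. -/
def substAll : Formula → (ℕ → Term) → Formula
  | falsum, _ => falsum
  | eq t u, v => eq (t.substAll v) (u.substAll v)
  | le t u, v => le (t.substAll v) (u.substAll v)
  | and φ ψ, v => and (substAll φ v) (substAll ψ v)
  | or φ ψ, v => or (substAll φ v) (substAll ψ v)
  | imp φ ψ, v => imp (substAll φ v) (substAll ψ v)
  | neg φ, v => neg (substAll φ v)
  | all x φ, v => all x (substAll φ (Function.update v x (Term.var x)))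
  | ex x φ, v => ex x (substAll φ (Function.update v x (Term.var x)))
  | box φ, v => box (substAll φ v)

/-- Substitution of the term `s` for the free occurrences of the variable `x`. -/
def subst (x : ℕ) (s : Term) (φ : Formula) : Formula :=
  substAll φ (Function.update Term.var x s)

/-- The term `s` is substitutable (free) for the variable `x` in the formula. -/
def freeFor (s : Term) (x : ℕ) : Formula → Prop
  | falsum => True
  | eq _ _ => True
  | le _ _ => True
  | and φ ψ => freeFor s x φ ∧ freeFor s x ψ
  | or φ ψ => freeFor s x φ ∧ freeFor s x ψ
  | imp φ ψ => freeFor s x φ ∧ freeFor s x ψ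
  | neg φ => freeFor s x φ
  | all y φ => x = y ∨ x ∉ fv φ ∨ (y ∉ s.fv ∧ freeFor s x φ)
  | ex y φ => x = y ∨ x ∉ fv φ ∨ (y ∉ s.fv ∧ freeFor s x φ)
  | box φ => freeFor s x φ

/-- The formula is an L_A-formula (contains no □). -/
def noBox : Formula → Prop
  | falsum => True
  | eq _ _ => True
  | le _ _ => True
  | and φ ψ => noBox φ ∧ noBox ψ
  | or φ ψ => noBox φ ∧ noBox ψ
  | imp φ ψ => noBox φ ∧ noBox ψ
  | neg φ => noBox φ
  | all _ φ => noBox φ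
  | ex _ φ => noBox φ
  | box _ => False

/-- Truth in the standard model ℕ under a valuation (meaningful for L_A-formulas;
boxed formulas are given the dummy value `False`). -/
def val : Formula → (ℕ → ℕ) → Prop
  | falsum, _ => False
  | eq t u, v => t.val v = u.val v
  | le t u, v => t.val v ≤ u.val v
  | and φ ψ, v => val φ v ∧ val ψ v
  | or φ ψ, v => val φ v ∨ val ψ v
  | imp φ ψ, v => val φ v → val ψ v
  | neg φ, v => ¬ val φ v
  | all x φ, v => ∀ n : ℕ, val φ (Function.update v x n)
  | ex x φ, v => ∃ n : ℕ, val φ (Function.update v x n)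
  | box _, _ => False

/-- Biconditional, as an abbreviation. -/
def iff (φ ψ : Formula) : Formula := (φ.imp ψ).and (ψ.imp φ)

/-- `t < u` abbreviates `S t ≤ u`. -/
def lt (t u : Term) : Formula := le (Term.succ t) u

/-- Bounded universal quantification `∀ x < t, φ`. -/
def ball (x : ℕ) (t : Term) (φ : Formula) : Formula :=
  all x ((lt (Term.var x) t).imp φ)

/-- Bounded existential quantification `∃ x < t, φ`. -/
def bex (x : ℕ) (t : Term) (φ : Formula) : Formula :=
  ex x ((lt (Term.var x) t).and φ)

/-- A Gödel numbering of formulas. -/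
def code : Formula → ℕ
  | falsum => Nat.pair 0 0
  | eq t u => Nat.pair 1 (Nat.pair t.code u.code)
  | le t u => Nat.pair 2 (Nat.pair t.code u.code)
  | and φ ψ => Nat.pair 3 (Nat.pair (code φ) (code ψ))
  | or φ ψ => Nat.pair 4 (Nat.pair (code φ) (code ψ))
  | imp φ ψ => Nat.pair 5 (Nat.pair (code φ) (code ψ))
  | neg φ => Nat.pair 6 (code φ)
  | all x φ => Nat.pair 7 (Nat.pair x (code φ))
  | ex x φ => Nat.pair 8 (Nat.pair x (code φ))
  | box φ => Nat.pair 9 (code φ)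

end Formula

/-- A sentence is a formula with no free variables. -/
def Sentence (φ : Formula) : Prop := φ.fv = ∅

/-- Truth in the standard model ℕ (for sentences; any fixed valuation will do). -/
def StdTrue (φ : Formula) : Prop := φ.val fun _ => 0

/-- The logical axioms of classical first-order logic with equality for L_□,
with the identity axioms only for atomic formulas. -/
inductive LogicalAxiom : Formula → Prop
  | imp1 (φ ψ : Formula) : LogicalAxiom (φ.imp (ψ.imp φ))
  | imp2 (φ ψ χ : Formula) :
      LogicalAxiom ((φ.imp (ψ.imp χ)).imp ((φ.imp ψ).imp (φ.imp χ)))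
  | dne (φ : Formula) : LogicalAxiom (φ.neg.neg.imp φ)
  | negI (φ ψ : Formula) : LogicalAxiom ((φ.imp ψ).imp ((φ.imp ψ.neg).imp φ.neg))
  | negE (φ ψ : Formula) : LogicalAxiom (φ.neg.imp (φ.imp ψ))
  | falsumE (φ : Formula) : LogicalAxiom (Formula.falsum.imp φ)
  | negIntro (φ : Formula) : LogicalAxiom ((φ.imp Formula.falsum).imp φ.neg)
  | negElimFalsum (φ : Formula) : LogicalAxiom (φ.neg.imp (φ.imp Formula.falsum))
  | andI (φ ψ : Formula) : LogicalAxiom (φ.imp (ψ.imp (φ.and ψ)))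
  | andE1 (φ ψ : Formula) : LogicalAxiom ((φ.and ψ).imp φ)
  | andE2 (φ ψ : Formula) : LogicalAxiom ((φ.and ψ).imp ψ)
  | orI1 (φ ψ : Formula) : LogicalAxiom (φ.imp (φ.or ψ))
  | orI2 (φ ψ : Formula) : LogicalAxiom (ψ.imp (φ.or ψ))
  | orE (φ ψ χ : Formula) :
      LogicalAxiom ((φ.imp χ).imp ((ψ.imp χ).imp ((φ.or ψ).imp χ)))
  | allE (x : ℕ) (t : Term) (φ : Formula) :
      φ.freeFor t x → LogicalAxiom ((Formula.all x φ).imp (φ.subst x t))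
  | allImp (x : ℕ) (φ ψ : Formula) :
      x ∉ φ.fv → LogicalAxiom ((Formula.all x (φ.imp ψ)).imp (φ.imp (Formula.all x ψ)))
  | exI (x : ℕ) (t : Term) (φ : Formula) :
      φ.freeFor t x → LogicalAxiom ((φ.subst x t).imp (Formula.ex x φ))
  | exE (x : ℕ) (φ ψ : Formula) :
      x ∉ ψ.fv → LogicalAxiom ((Formula.all x (φ.imp ψ)).imp ((Formula.ex x φ).imp ψ))
  | eqRefl (t : Term) : LogicalAxiom (Formula.eq t t)
  | eqSymm (t u : Term) : LogicalAxiom ((Formula.eq t u).imp (Formula.eq u t))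
  | eqTrans (t u w : Term) :
      LogicalAxiom ((Formula.eq t u).imp ((Formula.eq u w).imp (Formula.eq t w)))
  | eqSucc (t u : Term) :
      LogicalAxiom ((Formula.eq t u).imp (Formula.eq t.succ u.succ))
  | eqAdd (t₁ t₂ u₁ u₂ : Term) :
      LogicalAxiom ((Formula.eq t₁ t₂).imp ((Formula.eq u₁ u₂).imp
        (Formula.eq (t₁.add u₁) (t₂.add u₂))))
  | eqMul (t₁ t₂ u₁ u₂ : Term) :
      LogicalAxiom ((Formula.eq t₁ t₂).imp ((Formula.eq u₁ u₂).imp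
        (Formula.eq (t₁.mul u₁) (t₂.mul u₂))))
  | eqLe (t₁ t₂ u₁ u₂ : Term) :
      LogicalAxiom ((Formula.eq t₁ t₂).imp ((Formula.eq u₁ u₂).imp
        ((Formula.le t₁ u₁).imp (Formula.le t₂ u₂))))

/-- Provability in an L_□-theory: logical axioms, the axioms of the theory, and the
rules modus ponens, generalization, and necessitation. -/
inductive Provable (T : Set Formula) : Formula → Prop
  | ax {φ : Formula} : φ ∈ T → Provable T φ
  | logic {φ : Formula} : LogicalAxiom φ → Provable T φ
  | mp {φ ψ : Formula} : Provable T (φ.imp ψ) → Provable T φ → Provable T ψ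
  | gen {φ : Formula} (x : ℕ) : Provable T φ → Provable T (Formula.all x φ)
  | nec {φ : Formula} : Provable T φ → Provable T (Formula.box φ)

/-- First-order provability (no necessitation rule); used for the non-modal theory PA. -/
inductive FOProvable (T : Set Formula) : Formula → Prop
  | ax {φ : Formula} : φ ∈ T → FOProvable T φ
  | logic {φ : Formula} : LogicalAxiom φ → FOProvable T φ
  | mp {φ ψ : Formula} : FOProvable T (φ.imp ψ) → FOProvable T φ → FOProvable T ψ
  | gen {φ : Formula} (x : ℕ) : FOProvable T φ → FOProvable T (Formula.all x φ)

/-- Basic (Robinson-style) axioms of arithmetic. -/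
def succNeZero : Formula := (Formula.eq (Term.succ (Term.var 0)) Term.zero).neg
def succInj : Formula :=
  (Formula.eq (Term.succ (Term.var 0)) (Term.succ (Term.var 1))).imp
    (Formula.eq (Term.var 0) (Term.var 1))
def addZero : Formula := Formula.eq (Term.add (Term.var 0) Term.zero) (Term.var 0)
def addSucc : Formula :=
  Formula.eq (Term.add (Term.var 0) (Term.succ (Term.var 1)))
    (Term.succ (Term.add (Term.var 0) (Term.var 1)))
def mulZero : Formula := Formula.eq (Term.mul (Term.var 0) Term.zero) Term.zero
def mulSucc : Formula :=
  Formula.eq (Term.mul (Term.var 0) (Term.succ (Term.var 1)))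
    (Term.add (Term.mul (Term.var 0) (Term.var 1)) (Term.var 0))
def leDef : Formula :=
  (Formula.le (Term.var 0) (Term.var 1)).iff
    (Formula.ex 2 (Formula.eq (Term.add (Term.var 0) (Term.var 2)) (Term.var 1)))

def baseAxioms : Set Formula :=
  {succNeZero, succInj, addZero, addSucc, mulZero, mulSucc, leDef}

/-- The induction axiom for the formula `φ` and the variable `x`. -/
def inductionAx (x : ℕ) (φ : Formula) : Formula :=
  ((φ.subst x Term.zero).and
    (Formula.all x (φ.imp (φ.subst x (Term.succ (Term.var x)))))).imp
      (Formula.all x φ)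

/-- Peano arithmetic PA: basic axioms plus induction for L_A-formulas. -/
def PA : Set Formula :=
  baseAxioms ∪ {χ | ∃ (x : ℕ) (φ : Formula), φ.noBox ∧ χ = inductionAx x φ}

/-- PA_□ : basic axioms plus induction for all L_□-formulas. -/
def PABox : Set Formula :=
  baseAxioms ∪ {χ | ∃ (x : ℕ) (φ : Formula), χ = inductionAx x φ}

/-- The distribution axiom K. -/
def axK (φ ψ : Formula) : Formula :=
  (Formula.box (φ.imp ψ)).imp ((Formula.box φ).imp (Formula.box ψ))

/-- PA(K). -/
def PAK : Set Formula := PABox ∪ {χ | ∃ φ ψ : Formula, χ = axK φ ψ}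

/-- The axiom 4. -/
def ax4 (φ : Formula) : Formula := (Formula.box φ).imp (Formula.box (Formula.box φ))

/-- PA(K4). -/
def PAK4 : Set Formula := PAK ∪ {χ | ∃ φ : Formula, χ = ax4 φ}

/-- The axiom of Triv. -/
def axTriv (φ : Formula) : Formula := (Formula.box φ).iff φ

/-- PA(Triv). -/
def PATriv : Set Formula := PAK ∪ {χ | ∃ φ : Formula, χ = axTriv φ}

/-- PA(Ver). -/
def PAVer : Set Formula := PAK ∪ {Formula.box Formula.falsum}

/-- `T` extends `U`: every axiom of `U` is provable in `T`. -/
def Extends (T U : Set Formula) : Prop := ∀ φ ∈ U, Provable T φ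

/-- Consistency. -/
def Consistent (T : Set Formula) : Prop := ¬ Provable T Formula.falsum

/-- The class Δ₀ of bounded L_A-formulas. -/
inductive IsDelta0 : Formula → Prop
  | falsum : IsDelta0 Formula.falsum
  | eq (t u : Term) : IsDelta0 (Formula.eq t u)
  | le (t u : Term) : IsDelta0 (Formula.le t u)
  | and {φ ψ : Formula} : IsDelta0 φ → IsDelta0 ψ → IsDelta0 (φ.and ψ)
  | or {φ ψ : Formula} : IsDelta0 φ → IsDelta0 ψ → IsDelta0 (φ.or ψ)
  | imp {φ ψ : Formula} : IsDelta0 φ → IsDelta0 ψ → IsDelta0 (φ.imp ψ)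
  | neg {φ : Formula} : IsDelta0 φ → IsDelta0 φ.neg
  | ball {x : ℕ} {t : Term} {φ : Formula} :
      x ∉ t.fv → IsDelta0 φ → IsDelta0 (Formula.ball x t φ)
  | bex {x : ℕ} {t : Term} {φ : Formula} :
      x ∉ t.fv → IsDelta0 φ → IsDelta0 (Formula.bex x t φ)

/-- The class Σ₁ of L_A-formulas. -/
inductive IsSigma1 : Formula → Prop
  | delta0 {φ : Formula} : IsDelta0 φ → IsSigma1 φ
  | and {φ ψ : Formula} : IsSigma1 φ → IsSigma1 ψ → IsSigma1 (φ.and ψ)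
  | or {φ ψ : Formula} : IsSigma1 φ → IsSigma1 ψ → IsSigma1 (φ.or ψ)
  | ex {x : ℕ} {φ : Formula} : IsSigma1 φ → IsSigma1 (Formula.ex x φ)
  | ball {x : ℕ} {t : Term} {φ : Formula} :
      x ∉ t.fv → IsSigma1 φ → IsSigma1 (Formula.ball x t φ)

/-- The class B of boxed formulas. -/
def IsB (φ : Formula) : Prop := ∃ ψ : Formula, φ = Formula.box ψ

/-- The class ΔB. -/
inductive IsDeltaB : Formula → Prop
  | delta0 {φ : Formula} : IsDelta0 φ → IsDeltaB φ
  | b (ψ : Formula) : IsDeltaB (Formula.box ψ)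
  | and {φ ψ : Formula} : IsDeltaB φ → IsDeltaB ψ → IsDeltaB (φ.and ψ)
  | or {φ ψ : Formula} : IsDeltaB φ → IsDeltaB ψ → IsDeltaB (φ.or ψ)
  | ball {x : ℕ} {t : Term} {φ : Formula} :
      x ∉ t.fv → IsDeltaB φ → IsDeltaB (Formula.ball x t φ)
  | bex {x : ℕ} {t : Term} {φ : Formula} :
      x ∉ t.fv → IsDeltaB φ → IsDeltaB (Formula.bex x t φ)

/-- The class ΣB. -/
inductive IsSigmaB : Formula → Prop
  | sigma1 {φ : Formula} : IsSigma1 φ → IsSigmaB φ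
  | b (ψ : Formula) : IsSigmaB (Formula.box ψ)
  | and {φ ψ : Formula} : IsSigmaB φ → IsSigmaB ψ → IsSigmaB (φ.and ψ)
  | or {φ ψ : Formula} : IsSigmaB φ → IsSigmaB ψ → IsSigmaB (φ.or ψ)
  | ex {x : ℕ} {φ : Formula} : IsSigmaB φ → IsSigmaB (Formula.ex x φ)
  | ball {x : ℕ} {t : Term} {φ : Formula} :
      x ∉ t.fv → IsSigmaB φ → IsSigmaB (Formula.ball x t φ)

/-- Iterated disjunction (the empty disjunction is ⊥). -/
def disj : List Formula → Formula
  | [] => Formula.falsum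
  | [φ] => φ
  | φ :: ψ :: l => φ.or (disj (ψ :: l))

/-- Iterated conjunction (the empty conjunction is ⊤). -/
def conj : List Formula → Formula
  | [] => Formula.falsum.neg
  | [φ] => φ
  | φ :: ψ :: l => φ.and (conj (ψ :: l))

/-- Γ-disjunction property. -/
def HasDP (T : Set Formula) (Γ : Formula → Prop) : Prop :=
  ∀ φ ψ : Formula, Γ φ → Γ ψ → Sentence φ → Sentence ψ →
    Provable T (φ.or ψ) → Provable T φ ∨ Provable T ψ

/-- (Γ, Θ)-disjunction property. -/
def HasDP2 (T : Set Formula) (Γ Θ : Formula → Prop) : Prop :=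
  ∀ φ ψ : Formula, Γ φ → Θ ψ → Sentence φ → Sentence ψ →
    Provable T (φ.or ψ) → Provable T φ ∨ Provable T ψ

/-- Γ-existence property. -/
def HasEP (T : Set Formula) (Γ : Formula → Prop) : Prop :=
  ∀ (x : ℕ) (φ : Formula), Γ φ → φ.fv ⊆ {x} →
    Provable T (Formula.ex x φ) → ∃ n : ℕ, Provable T (φ.subst x (Term.numeral n))

/-- Modal disjunction property. -/
def HasMDP (T : Set Formula) : Prop :=
  ∀ φ ψ : Formula, Sentence φ → Sentence ψ →
    Provable T ((Formula.box φ).or (Formula.box ψ)) → Provable T φ ∨ Provable T ψ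

/-- Modal existence property. -/
def HasMEP (T : Set Formula) : Prop :=
  ∀ (x : ℕ) (φ : Formula), φ.fv ⊆ {x} →
    Provable T (Formula.ex x (Formula.box φ)) →
      ∃ n : ℕ, Provable T (φ.subst x (Term.numeral n))

/-- n-fold B-disjunction property. -/
def HasBnDP (T : Set Formula) (n : ℕ) : Prop :=
  ∀ φ : Fin n → Formula, (∀ i, Sentence (φ i)) →
    Provable T (disj (List.ofFn fun i => Formula.box (φ i))) →
    ∃ i, Provable T (Formula.box (φ i))

/-- Σ₁-soundness. -/
def Sigma1Sound (T : Set Formula) : Prop :=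
  ∀ φ : Formula, IsSigma1 φ → Sentence φ → Provable T φ → StdTrue φ

/-- L_A-soundness. -/
def LASound (T : Set Formula) : Prop :=
  ∀ φ : Formula, φ.noBox → Sentence φ → Provable T φ → StdTrue φ

/-- `T` is recursively enumerable (via the Gödel numbering of formulas). -/
def RE (T : Set Formula) : Prop :=
  Nat.Partrec fun n => Part.assert (∃ φ ∈ T, Formula.code φ = n) fun _ => Part.some 0

/-- A fixed natural Σ₁ provability predicate `Pr_T(x)` for the theory `T`:
a Σ₁ L_A-formula with only the free variable `0` which numerates provability in `T`
in the standard model and satisfies the standard derivability conditions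
(provably in PA). -/
structure ProvPred (T : Set Formula) where
  pr : Formula
  noBox : pr.noBox
  sigma1 : IsSigma1 pr
  fvSub : pr.fv ⊆ {0}
  numerates : ∀ φ : Formula,
    StdTrue (pr.subst 0 (Term.numeral φ.code)) ↔ Provable T φ
  d1 : ∀ φ : Formula, Provable T φ → FOProvable PA (pr.subst 0 (Term.numeral φ.code))
  d2 : ∀ φ ψ : Formula,
    FOProvable PA ((pr.subst 0 (Term.numeral (φ.imp ψ).code)).imp
      ((pr.subst 0 (Term.numeral φ.code)).imp (pr.subst 0 (Term.numeral ψ.code))))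
  necClosed : ∀ φ : Formula,
    FOProvable PA ((pr.subst 0 (Term.numeral φ.code)).imp
      (pr.subst 0 (Term.numeral (Formula.box φ).code)))

/-- `Pr_T(⌜φ⌝)`. -/
def ProvPred.app {T : Set Formula} (P : ProvPred T) (φ : Formula) : Formula :=
  P.pr.subst 0 (Term.numeral φ.code)

/-- Γ-disjunctive correctness (Γ-DC). -/
def DC (T : Set Formula) (P : ProvPred T) (Γ : Formula → Prop) : Prop :=
  ∀ φ : Formula, Γ φ → Sentence φ → Provable T (φ.or (P.app φ)) → Provable T φ

/-- The substitution replacing each variable by the numeral of its value. -/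
def numeralSubst (v : ℕ → ℕ) : ℕ → Term := fun x => Term.numeral (v x)

/-- Standard-model satisfaction of the ρ_T-translation: `ρ_T` is the identity on
L_A-formulas, commutes with connectives and quantifiers, and sends `□φ(x⃗)` to
`Pr_T(⌜□φ(ẋ⃗)⌝)`, whose truth in ℕ (for a natural provability predicate) amounts to
provability in `T` of `□φ(n̄⃗)`. -/
def RhoSat (T : Set Formula) : Formula → (ℕ → ℕ) → Prop
  | .falsum, _ => False
  | .eq t u, v => t.val v = u.val v
  | .le t u, v => t.val v ≤ u.val v
  | .and φ ψ, v => RhoSat T φ v ∧ RhoSat T ψ v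
  | .or φ ψ, v => RhoSat T φ v ∨ RhoSat T ψ v
  | .imp φ ψ, v => RhoSat T φ v → RhoSat T ψ v
  | .neg φ, v => ¬ RhoSat T φ v
  | .all x φ, v => ∀ n : ℕ, RhoSat T φ (Function.update v x n)
  | .ex x φ, v => ∃ n : ℕ, RhoSat T φ (Function.update v x n)
  | .box φ, v => Provable T (Formula.box (φ.substAll (numeralSubst v)))

/-- Standard-model satisfaction of the π_T-translation: `π_T` is the identity on
L_A-formulas, commutes with connectives and quantifiers, and sends `□φ(x⃗)` to
`Pr_T(⌜φ(ẋ⃗)⌝)`, whose truth in ℕ (for a natural provability predicate) amounts to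
provability in `T` of `φ(n̄⃗)`. -/
def PiSat (T : Set Formula) : Formula → (ℕ → ℕ) → Prop
  | .falsum, _ => False
  | .eq t u, v => t.val v = u.val v
  | .le t u, v => t.val v ≤ u.val v
  | .and φ ψ, v => PiSat T φ v ∧ PiSat T ψ v
  | .or φ ψ, v => PiSat T φ v ∨ PiSat T ψ v
  | .imp φ ψ, v => PiSat T φ v → PiSat T ψ v
  | .neg φ, v => ¬ PiSat T φ v
  | .all x φ, v => ∀ n : ℕ, PiSat T φ (Function.update v x n)
  | .ex x φ, v => ∃ n : ℕ, PiSat T φ (Function.update v x n)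
  | .box φ, v => Provable T (φ.substAll (numeralSubst v))

/-- Weak ΣB-soundness: every provable ΣB sentence is true in ℕ under ρ_T. -/
def WeaklySigmaBSound (T : Set Formula) : Prop :=
  ∀ φ : Formula, IsSigmaB φ → Sentence φ → Provable T φ → RhoSat T φ fun _ => 0

/-- ΣB-soundness: every provable ΣB sentence is true in ℕ under π_T. -/
def SigmaBSound (T : Set Formula) : Prop :=
  ∀ φ : Formula, IsSigmaB φ → Sentence φ → Provable T φ → PiSat T φ fun _ => 0

end ModalArith

namespace ModalArith

theorem Term.substAll_var (t : Term) : t.substAll Term.var = t := by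
  induction t <;> simp_all [Term.substAll]

theorem Term.substAll_congr (t : Term) (v w : ℕ → Term) (h : ∀ y ∈ t.fv, v y = w y) :
    t.substAll v = t.substAll w := by
  induction t <;> simp_all [Term.substAll, Term.fv]

theorem Term.val_substAll (t : Term) (w : ℕ → Term) (v : ℕ → ℕ) :
    (t.substAll w).val v = t.val (fun y => (w y).val v) := by
  induction t <;> simp_all [Term.substAll, Term.val]

theorem Term.val_congr (t : Term) (v w : ℕ → ℕ) (h : ∀ y ∈ t.fv, v y = w y) :
    t.val v = t.val w := by
  induction t <;> simp_all [Term.val, Term.fv]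

theorem Formula.substAll_var (φ : Formula) : φ.substAll Term.var = φ := by
  induction φ <;> simp_all [Formula.substAll, Term.substAll_var]

theorem Formula.substAll_congr (φ : Formula) : ∀ (v w : ℕ → Term),
    (∀ y ∈ φ.fv, v y = w y) → φ.substAll v = φ.substAll w := by
  induction φ with
  | falsum => intros; rfl
  | eq t u =>
    intro v w h
    simp only [Formula.fv, Finset.mem_union] at h
    simp only [Formula.substAll]
    rw [Term.substAll_congr t v w (fun y hy => h y (.inl hy)),
      Term.substAll_congr u v w (fun y hy => h y (.inr hy))]
  | le t u =>
    intro v w h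
    simp only [Formula.fv, Finset.mem_union] at h
    simp only [Formula.substAll]
    rw [Term.substAll_congr t v w (fun y hy => h y (.inl hy)),
      Term.substAll_congr u v w (fun y hy => h y (.inr hy))]
  | and a b iha ihb | or a b iha ihb | imp a b iha ihb =>
    intro v w h
    simp only [Formula.fv, Finset.mem_union] at h
    simp only [Formula.substAll]
    rw [iha v w (fun y hy => h y (.inl hy)), ihb v w (fun y hy => h y (.inr hy))]
  | neg a ih | box a ih =>
    intro v w h
    simp only [Formula.substAll]
    rw [ih v w h]
  | all x a ih | ex x a ih =>
    intro v w h
    simp only [Formula.substAll]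
    rw [ih _ (Function.update w x (Term.var x))]
    intro y hy
    by_cases hxy : y = x
    · subst hxy; simp
    · simp [hxy]; exact h y (by simp [Formula.fv, hxy, hy])

theorem Formula.val_congr (φ : Formula) : ∀ (v w : ℕ → ℕ),
    (∀ y ∈ φ.fv, v y = w y) → (φ.val v ↔ φ.val w) := by
  induction φ with
  | falsum => intros; rfl
  | eq t u | le t u =>
    intro v w h
    simp only [Formula.fv, Finset.mem_union] at h
    simp only [Formula.val]
    rw [Term.val_congr t v w (fun y hy => h y (.inl hy)),
      Term.val_congr u v w (fun y hy => h y (.inr hy))]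
  | and a b iha ihb | or a b iha ihb | imp a b iha ihb =>
    intro v w h
    simp only [Formula.fv, Finset.mem_union] at h
    simp only [Formula.val]
    rw [iha v w (fun y hy => h y (.inl hy)), ihb v w (fun y hy => h y (.inr hy))]
  | neg a ih =>
    intro v w h
    simp only [Formula.val]
    rw [ih v w h]
  | box a ih => intros; rfl
  | all x a ih =>
    intro v w h
    simp only [Formula.val]
    refine forall_congr' fun n => ih _ _ fun y hy => ?_
    by_cases hxy : y = x
    · subst hxy; simp
    · simp [hxy]; exact h y (by simp [Formula.fv, hxy, hy])
  | ex x a ih =>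
    intro v w h
    simp only [Formula.val]
    refine exists_congr fun n => ih _ _ fun y hy => ?_
    by_cases hxy : y = x
    · subst hxy; simp
    · simp [hxy]; exact h y (by simp [Formula.fv, hxy, hy])

theorem update_val (x : ℕ) (s : Term) (v : ℕ → ℕ) :
    (fun y => (Function.update Term.var x s y).val v) = Function.update v x (s.val v) := by
  funext y
  by_cases hxy : y = x
  · subst hxy; simp
  · simp [hxy, Term.val]

theorem Formula.subst_notMem (φ : Formula) (x : ℕ) (s : Term) (h : x ∉ φ.fv) :
    φ.substAll (Function.update Term.var x s) = φ := by
  rw [Formula.substAll_congr φ _ Term.var, Formula.substAll_var]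
  intro y hy
  have : y ≠ x := by rintro rfl; exact h hy
  simp [this]

theorem Formula.subst_under (a : Formula) (x y : ℕ) (s : Term)
    (h : x = y ∨ x ∉ a.fv ∨ (y ∉ s.fv ∧ a.freeFor s x))
    (ih : a.freeFor s x → ∀ v : ℕ → ℕ,
      (a.substAll (Function.update Term.var x s)).val v ↔ a.val (Function.update v x (s.val v)))
    (v : ℕ → ℕ) (n : ℕ) :
    (a.substAll (Function.update (Function.update Term.var x s) y (Term.var y))).val
      (Function.update v y n) ↔
    a.val (Function.update (Function.update v x (s.val v)) y n) := by
  by_cases hxy : x = y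
  · subst hxy
    simp [Formula.substAll_var]
  · have e : Function.update (Function.update Term.var x s) y (Term.var y)
        = Function.update Term.var x s := by
      apply Function.update_eq_self_iff.2
      simp [Ne.symm hxy]
    rw [e, Function.update_comm hxy]
    rcases h with h | h | ⟨h1, h2⟩
    · exact absurd h hxy
    · rw [Formula.subst_notMem a x s h]
      apply Formula.val_congr
      intro z hz
      have : z ≠ x := by rintro rfl; exact h hz
      simp [this]
    · rw [ih h2]
      rw [Term.val_congr s (Function.update v y n) v]
      intro z hz
      have : z ≠ y := by rintro rfl; exact h1 hz
      simp [this]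

theorem Formula.val_subst (x : ℕ) (s : Term) (φ : Formula) : φ.freeFor s x → ∀ v : ℕ → ℕ,
    ((φ.substAll (Function.update Term.var x s)).val v ↔
      φ.val (Function.update v x (s.val v))) := by
  induction φ with
  | falsum => intros; rfl
  | eq t u | le t u =>
    intro _ v
    simp only [Formula.substAll, Formula.val, Term.val_substAll, update_val]
  | and a b iha ihb | or a b iha ihb | imp a b iha ihb =>
    intro h v
    simp only [Formula.substAll, Formula.val]
    rw [iha h.1 v, ihb h.2 v]
  | neg a ih =>
    intro h v
    simp only [Formula.substAll, Formula.val]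
    rw [ih h v]
  | box a ih => intros; rfl
  | all y a ih =>
    intro h v
    simp only [Formula.substAll, Formula.val]
    exact forall_congr' fun n => Formula.subst_under a x y s h ih v n
  | ex y a ih =>
    intro h v
    simp only [Formula.substAll, Formula.val]
    exact exists_congr fun n => Formula.subst_under a x y s h ih v n

theorem update_notMem (φ : Formula) (x n : ℕ) (v : ℕ → ℕ) (h : x ∉ φ.fv) :
    φ.val (Function.update v x n) ↔ φ.val v := by
  apply Formula.val_congr
  intro z hz
  have : z ≠ x := by rintro rfl; exact h hz
  simp [this]

theorem LogicalAxiom.sound {φ : Formula} (h : LogicalAxiom φ) (v : ℕ → ℕ) : φ.val v := by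
  cases h with
  | allE x t a hf =>
    intro h
    exact (Formula.val_subst x t a hf v).2 (h _)
  | exI x t a hf =>
    intro h
    exact ⟨_, (Formula.val_subst x t a hf v).1 h⟩
  | allImp x a b hx =>
    intro h ha n
    exact h n ((update_notMem a x n v hx).2 ha)
  | exE x a b hx =>
    rintro h ⟨n, hn⟩
    exact (update_notMem b x n v hx).1 (h n hn)
  | _ => simp only [Formula.val, Term.val] <;> first | tauto | (intros; simp_all)

/-- Substitutability of closed terms and of terms over the substituted variable. -/
theorem val_subst_ind (x : ℕ) (s : Term) (hs : s.fv ⊆ {x}) (φ : Formula) : φ.freeFor s x := by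
  induction φ with
  | falsum | eq | le => trivial
  | and a b iha ihb | or a b iha ihb | imp a b iha ihb => exact ⟨iha, ihb⟩
  | neg a ih | box a ih => exact ih
  | all y a ih | ex y a ih =>
    by_cases h : x = y
    · exact .inl h
    · refine .inr (.inr ⟨fun hy => h ?_, ih⟩)
      exact (Finset.mem_singleton.1 (hs hy)).symm

theorem PA_sound {φ : Formula} (h : φ ∈ PA) (v : ℕ → ℕ) : φ.val v := by
  rcases h with h | ⟨x, a, -, rfl⟩
  · simp only [baseAxioms, Set.mem_insert_iff, Set.mem_singleton_iff] at h
    rcases h with rfl | rfl | rfl | rfl | rfl | rfl | rfl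
    · simp [succNeZero, Formula.val, Term.val]
    · simp [succInj, Formula.val, Term.val]
    · simp [addZero, Formula.val, Term.val]
    · simp [addSucc, Formula.val, Term.val]; omega
    · simp [mulZero, Formula.val, Term.val]
    · simp [mulSucc, Formula.val, Term.val]; ring
    · simp only [leDef, Formula.iff, Formula.val, Term.val]
      simp
      constructor
      · intro h; exact ⟨v 1 - v 0, by omega⟩
      · intro n h; omega
  · rintro ⟨h0, hs⟩ n
    induction n with
    | zero =>
      exact (Formula.val_subst x Term.zero a
        (val_subst_ind x _ (by simp [Term.fv]) a) v).1 h0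
    | succ n ih =>
      have := (Formula.val_subst x (Term.succ (Term.var x)) a
        (val_subst_ind x _ (by simp [Term.fv]) a) _).1 (hs n ih)
      simpa [Term.val] using this

theorem FOProvable.sound {φ : Formula} (h : FOProvable PA φ) : ∀ v : ℕ → ℕ, φ.val v := by
  induction h with
  | ax h => exact PA_sound h
  | logic h => exact h.sound
  | mp _ _ ih1 ih2 => exact fun v => ih1 v (ih2 v)
  | gen x _ ih => exact fun v n => ih _

/-- The translation replacing every boxed formula by `0 = 0`. -/
def Formula.tr : Formula → Formula
  | falsum => falsum
  | eq t u => eq t u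
  | le t u => le t u
  | and φ ψ => and (tr φ) (tr ψ)
  | or φ ψ => or (tr φ) (tr ψ)
  | imp φ ψ => imp (tr φ) (tr ψ)
  | neg φ => neg (tr φ)
  | all x φ => all x (tr φ)
  | ex x φ => ex x (tr φ)
  | box _ => eq Term.zero Term.zero

theorem Formula.tr_noBox (φ : Formula) : φ.tr.noBox := by
  induction φ <;> simp_all [Formula.tr, Formula.noBox]

theorem Formula.tr_eq (φ : Formula) (h : φ.noBox) : φ.tr = φ := by
  induction φ <;> simp_all [Formula.tr, Formula.noBox]

theorem Formula.tr_fv (φ : Formula) : ∀ x, x ∈ φ.tr.fv → x ∈ φ.fv := by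
  induction φ with
  | box a ih => simp [Formula.tr, Formula.fv, Term.fv]
  | and a b iha ihb | or a b iha ihb | imp a b iha ihb =>
    intro x
    simp only [Formula.tr, Formula.fv, Finset.mem_union]
    exact Or.imp (iha x) (ihb x)
  | all y a ih | ex y a ih =>
    intro x
    simp only [Formula.tr, Formula.fv, Finset.mem_erase]
    exact And.imp_right (ih x)
  | neg a ih => exact ih
  | _ => exact fun x h => h

theorem Formula.tr_substAll (φ : Formula) : ∀ w, (φ.substAll w).tr = φ.tr.substAll w := by
  induction φ <;> simp_all [Formula.tr, Formula.substAll, Term.substAll]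

theorem Formula.tr_subst (φ : Formula) (x : ℕ) (s : Term) :
    (φ.subst x s).tr = φ.tr.subst x s := Formula.tr_substAll φ _

theorem Formula.tr_freeFor (φ : Formula) (s : Term) (x : ℕ) :
    φ.freeFor s x → φ.tr.freeFor s x := by
  induction φ with
  | falsum | eq | le | box => intro _; trivial
  | and a b iha ihb | or a b iha ihb | imp a b iha ihb => exact And.imp iha ihb
  | neg a ih => exact ih
  | all y a ih | ex y a ih =>
    exact Or.imp_right (Or.imp (fun h h' => h (Formula.tr_fv a x h')) (And.imp_right ih))

theorem LogicalAxiom.tr {φ : Formula} (h : LogicalAxiom φ) : LogicalAxiom φ.tr := by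
  cases h with
  | allE x t a hf =>
    simp only [Formula.tr, Formula.tr_subst]
    exact .allE x t _ (Formula.tr_freeFor a t x hf)
  | exI x t a hf =>
    simp only [Formula.tr, Formula.tr_subst]
    exact .exI x t _ (Formula.tr_freeFor a t x hf)
  | allImp x a b hx => exact .allImp x _ _ (fun h => hx (Formula.tr_fv a x h))
  | exE x a b hx => exact .exE x _ _ (fun h => hx (Formula.tr_fv b x h))
  | _ => simp only [Formula.tr]; constructor

theorem Provable.tr {φ : Formula} (h : Provable PAVer φ) : FOProvable PA φ.tr := by
  induction h with
  | ax h =>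
    rcases h with ((h | ⟨x, a, rfl⟩) | ⟨a, b, rfl⟩) | h
    · rw [Formula.tr_eq]
      · exact .ax (.inl h)
      · simp only [baseAxioms, Set.mem_insert_iff, Set.mem_singleton_iff] at h
        rcases h with rfl | rfl | rfl | rfl | rfl | rfl | rfl <;>
          simp [succNeZero, succInj, addZero, addSucc, mulZero, mulSucc, leDef, Formula.iff,
            Formula.noBox]
    · refine .ax (.inr ⟨x, a.tr, a.tr_noBox, ?_⟩)
      simp only [inductionAx, Formula.tr, Formula.tr_subst]
    · exact .logic (.imp1 _ _)
    · rw [Set.mem_singleton_iff.1 h]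
      exact .logic (.eqRefl _)
  | logic h => exact .logic h.tr
  | mp _ _ ih1 ih2 => exact .mp ih1 ih2
  | gen x _ ih => exact .gen x ih
  | nec _ _ => exact .logic (.eqRefl _)

/-- PA(Ver) is a conservative extension of PA; in particular PA(Ver) is L_A-sound. -/
theorem statement2 :
    (∀ φ : Formula, φ.noBox → Sentence φ → Provable PAVer φ → FOProvable PA φ) ∧
    LASound PAVer := by
  have key : ∀ φ : Formula, φ.noBox → Provable PAVer φ → FOProvable PA φ := by
    intro φ hn h
    have := h.tr
    rwa [Formula.tr_eq φ hn] at this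
  exact ⟨fun φ hn _ h => key φ hn h, fun φ hn _ h => (key φ hn h).sound _⟩

end ModalArith
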